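/- arXiv:1212.6069 — 4 statements merged into one kernel-verified Lean document; each statement's English description precedes it below -/
import Mathlib

section
/- For every n×n matrix A with entries in ℝ ∪ {-∞}, the sequence ‖A^k‖/k converges in ℝ ∪ {-∞} (with the convention that x/k = -∞ when x = -∞) to the spectral radius ρ(A) as k → ∞; that is, lim_{k→∞} ‖A^k‖/k = ρ(A). -/
open MeasureTheory ProbabilityTheory Filter
open scoped Classical

noncomputable section

/-- Max-plus matrix product. -/
def mpMul {m n l : ℕ} (A : Fin m → Fin n → EReal) (B : Fin n → Fin l → EReal) :
    Fin m → Fin l → EReal := fun i j => ⨆ s, A i s + B s j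

/-- Max-plus identity matrix. -/
def mpId {n : ℕ} : Fin n → Fin n → EReal := fun i j => if i = j then 0 else ⊥

/-- Max-plus matrix power. -/
def mpPow {n : ℕ} (A : Fin n → Fin n → EReal) : ℕ → (Fin n → Fin n → EReal)
  | 0 => mpId
  | k + 1 => mpMul (mpPow A k) A

/-- Max-plus norm: maximum entry. -/
def mpNorm {m n : ℕ} (A : Fin m → Fin n → EReal) : EReal := ⨆ i, ⨆ j, A i j

/-- Max-plus trace: maximum diagonal entry. -/
def mpTr {n : ℕ} (A : Fin n → Fin n → EReal) : EReal := ⨆ i, A i i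

/-- Division of an extended real by a natural number (so that `⊥ / k = ⊥` for `k ≥ 1`). -/
def edivNat (x : EReal) (k : ℕ) : EReal := x * (((k : ℝ)⁻¹ : ℝ) : EReal)

/-- Max-plus spectral radius `ρ(A) = max_{1 ≤ m ≤ n} tr(A^m)/m`. -/
def mpRho {n : ℕ} (A : Fin n → Fin n → EReal) : EReal :=
  ⨆ m : Fin n, edivNat (mpTr (mpPow A ((m : ℕ) + 1))) ((m : ℕ) + 1)

/-- The product `A(1) ⊗ ⋯ ⊗ A(k)`, where `A j` stands for the matrix `A(j+1)`. -/
def mpProdSeq {n : ℕ} (A : ℕ → Fin n → Fin n → EReal) : ℕ → (Fin n → Fin n → EReal)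
  | 0 => mpId
  | k + 1 => mpMul (mpProdSeq A k) (A k)

/-- Max-plus matrix-vector product. -/
def mpMulVec {m n : ℕ} (A : Fin m → Fin n → EReal) (x : Fin n → EReal) : Fin m → EReal :=
  fun i => ⨆ l, A i l + x l

/-- Max-plus norm of a vector. -/
def mpVecNorm {n : ℕ} (x : Fin n → EReal) : EReal := ⨆ i, x i

/-- Entrywise max-plus addition (entrywise maximum). -/
def mpAdd {m n : ℕ} (A B : Fin m → Fin n → EReal) : Fin m → Fin n → EReal :=
  fun i j => max (A i j) (B i j)

/-- Expectation of an `EReal`-valued random variable, following the convention that a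
variable which is (almost surely) equal to `-∞` has expectation `-∞`. -/
def eExp {Ω : Type*} [MeasurableSpace Ω] (μ : Measure Ω) (X : Ω → EReal) : EReal :=
  if ∀ᵐ ω ∂μ, X ω = ⊥ then ⊥ else ((∫ ω, (X ω).toReal ∂μ : ℝ) : EReal)

theorem edivNat_le_coe_iff {x : EReal} {k : ℕ} (hk : 0 < k) (c : ℝ) :
    edivNat x k ≤ c ↔ x ≤ ((k * c : ℝ) : EReal) := by
  have hk' : (0 : ℝ) < (k : ℝ) := by exact_mod_cast hk
  have hi : (0 : ℝ) < (k : ℝ)⁻¹ := inv_pos.mpr hk'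
  unfold edivNat
  induction x with
  | bot => simp [EReal.bot_mul_coe_of_pos hi]
  | top =>
    rw [EReal.top_mul_coe_of_pos hi, top_le_iff, top_le_iff]
    exact iff_of_false (EReal.coe_ne_top _) (EReal.coe_ne_top _)
  | coe x =>
    rw [← EReal.coe_mul, EReal.coe_le_coe_iff, EReal.coe_le_coe_iff, ← div_eq_mul_inv,
      div_le_iff₀ hk', mul_comm]

theorem coe_lt_edivNat_iff {x : EReal} {k : ℕ} (hk : 0 < k) (c : ℝ) :
    (c : EReal) < edivNat x k ↔ ((k * c : ℝ) : EReal) < x := by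
  rw [← not_le, edivNat_le_coe_iff hk, not_le]

section

variable {n : ℕ} (A : Fin n → Fin n → EReal)

theorem mpPow_add_le_succ (k : ℕ) (i s j : Fin n) :
    mpPow A k i s + A s j ≤ mpPow A (k + 1) i j :=
  le_iSup (fun s => mpPow A k i s + A s j) s

theorem exists_mpPow_succ_eq (k : ℕ) (i j : Fin n) :
    ∃ s, mpPow A (k + 1) i j = mpPow A k i s + A s j := by
  have : Nonempty (Fin n) := ⟨i⟩
  obtain ⟨s, hs⟩ := exists_eq_ciSup_of_finite (f := fun s => mpPow A k i s + A s j)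
  exact ⟨s, hs.symm⟩

theorem mpPow_add_mpPow_le (a b : ℕ) (i l j : Fin n) :
    mpPow A a i l + mpPow A b l j ≤ mpPow A (a + b) i j := by
  induction b generalizing j with
  | zero =>
    by_cases h : l = j <;> simp [mpPow, mpId, h]
  | succ b ih =>
    obtain ⟨s, hs⟩ := exists_mpPow_succ_eq A b l j
    rw [hs, ← add_assoc, ← add_assoc]
    exact (add_le_add_left (ih s) _).trans (mpPow_add_le_succ A _ i s j)

theorem sum_le_mpPow (v : ℕ → Fin n) (a m : ℕ) :
    ∑ t ∈ Finset.range m, A (v (a + t)) (v (a + t + 1)) ≤ mpPow A m (v a) (v (a + m)) := by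
  induction m with
  | zero => simp [mpPow, mpId]
  | succ m ih =>
    rw [Finset.sum_range_succ]
    exact (add_le_add_left ih _).trans (mpPow_add_le_succ A m _ _ _)

theorem mpPow_eq_bot_or_exists_walk (k : ℕ) (i j : Fin n) :
    mpPow A k i j = ⊥ ∨ ∃ v : ℕ → Fin n, v 0 = i ∧ v k = j ∧
      mpPow A k i j = ∑ t ∈ Finset.range k, A (v t) (v (t + 1)) := by
  induction k generalizing j with
  | zero =>
    by_cases h : i = j
    · exact Or.inr ⟨fun _ => i, rfl, h, by simp [mpPow, mpId, h]⟩
    · exact Or.inl (by simp [mpPow, mpId, h])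
  | succ k ih =>
    obtain ⟨s, hs⟩ := exists_mpPow_succ_eq A k i j
    rcases ih s with h | ⟨v, h0, hk, hv⟩
    · left
      rw [hs, h, EReal.bot_add]
    · refine Or.inr ⟨Function.update v (k + 1) j, by simp [h0], by simp, ?_⟩
      rw [hs, hv, Finset.sum_range_succ]
      congr 1
      · refine Finset.sum_congr rfl fun t ht => ?_
        have := Finset.mem_range.mp ht
        rw [Function.update_of_ne (by omega), Function.update_of_ne (by omega)]
      · simp [hk]

/-- A power of exponent at least `n` can be split around a closed walk of length at most `n`. -/
theorem exists_mpPow_le_cycle (k : ℕ) (hk : n ≤ k) (i j : Fin n) :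
    ∃ m r, 0 < m ∧ m ≤ n ∧ k = m + r ∧
      ∃ c, mpPow A k i j ≤ mpPow A m c c + mpPow A r i j := by
  have hn : 0 < n := i.pos
  rcases mpPow_eq_bot_or_exists_walk A k i j with h | ⟨v, h0, hkj, hv⟩
  · exact ⟨1, k - 1, one_pos, hn, by omega, i, by simp [h]⟩
  obtain ⟨p, q, hpq, hq, hvpq⟩ : ∃ p q, p < q ∧ q ≤ n ∧ v p = v q := by
    obtain ⟨x, y, hxy, h⟩ := Fintype.exists_ne_map_eq_of_card_lt
      (fun t : Fin (n + 1) => v t) (by simp)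
    rcases lt_or_gt_of_ne hxy with hlt | hlt
    · exact ⟨x, y, hlt, by omega, h⟩
    · exact ⟨y, x, hlt, by omega, h.symm⟩
  obtain ⟨m, rfl⟩ := Nat.exists_eq_add_of_lt hpq
  obtain ⟨r, rfl⟩ := Nat.exists_eq_add_of_le (hq.trans hk)
  refine ⟨m + 1, p + r, by omega, by omega, by omega, v p, ?_⟩
  rw [hv, show p + m + 1 + r = p + ((m + 1) + r) by omega, Finset.sum_range_add,
    Finset.sum_range_add]
  have e1 := sum_le_mpPow A v 0 p
  have e2 := sum_le_mpPow A v p (m + 1)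
  have e3 := sum_le_mpPow A v (p + (m + 1)) r
  simp only [zero_add, ← add_assoc] at e1 e2 e3 ⊢
  rw [h0] at e1
  rw [← hvpq] at e2
  rw [hkj, ← hvpq] at e3
  have e4 := mpPow_add_mpPow_le A p r i (v p) j
  calc _ ≤ mpPow A p i (v p) + mpPow A (m + 1) (v p) (v p) + mpPow A r (v p) j :=
        add_le_add (add_le_add e1 e2) e3
    _ = mpPow A (m + 1) (v p) (v p) + (mpPow A p i (v p) + mpPow A r (v p) j) := by
        rw [add_comm (mpPow A p i (v p)), add_assoc]
    _ ≤ _ := add_le_add_right e4 _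

variable {A}

theorem exists_real_upper_bound (hA : ∀ i j, A i j ≠ ⊤) (l : ℝ) :
    ∃ M : ℝ, l ≤ M ∧ ∀ i j, A i j ≤ M := by
  obtain ⟨M, hM⟩ := Finite.exists_le (fun x : Fin n × Fin n => (A x.1 x.2).toReal)
  exact ⟨max l M, le_max_left _ _, fun i j => (EReal.le_coe_toReal (hA i j)).trans
    (EReal.coe_le_coe_iff.mpr ((hM (i, j)).trans (le_max_right _ _)))⟩

theorem mpPow_le_mpNorm (k : ℕ) (i j : Fin n) : mpPow A k i j ≤ mpNorm (mpPow A k) :=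
  le_iSup₂ (f := fun i j => mpPow A k i j) i j

theorem mpNorm_mpPow_add_le {M : ℝ} (hM : ∀ i j, A i j ≤ M) (k r : ℕ) :
    mpNorm (mpPow A (k + r)) ≤ mpNorm (mpPow A k) + ((r * M : ℝ) : EReal) := by
  induction r with
  | zero => simp
  | succ r ih =>
    refine iSup₂_le fun i j => iSup_le fun s => ?_
    calc mpPow A (k + r) i s + A s j
        ≤ mpNorm (mpPow A k) + ((r * M : ℝ) : EReal) + (M : EReal) :=
          add_le_add ((mpPow_le_mpNorm _ _ _).trans ih) (hM s j)
      _ = _ := by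
          rw [add_assoc, ← EReal.coe_add, Nat.cast_succ, add_one_mul]

theorem mpPow_le_mul {M : ℝ} (hM : ∀ i j, A i j ≤ M) (k : ℕ) (i j : Fin n) :
    mpPow A k i j ≤ ((k * M : ℝ) : EReal) := by
  have h0 : mpNorm (mpPow A 0) ≤ 0 := iSup₂_le fun i j => by
    by_cases h : i = j <;> simp [mpPow, mpId, h]
  have h := mpNorm_mpPow_add_le hM 0 k
  rw [zero_add] at h
  calc _ ≤ _ := (mpPow_le_mpNorm k i j).trans h
    _ ≤ 0 + _ := add_le_add_left h0 _
    _ = _ := zero_add _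

theorem mpPow_diag_le_of_mpRho_le {l : ℝ} (hl : mpRho A ≤ l) {m : ℕ} (hm : 0 < m)
    (hmn : m ≤ n) (i : Fin n) : mpPow A m i i ≤ ((m * l : ℝ) : EReal) := by
  obtain ⟨m, rfl⟩ := Nat.exists_eq_succ_of_ne_zero hm.ne'
  have h := (iSup_le_iff.mp hl) ⟨m, hmn⟩
  rw [edivNat_le_coe_iff (by simp)] at h
  exact (le_iSup (fun i => mpPow A (m + 1) i i) i).trans h

theorem mpNorm_mpPow_le_of_mpRho_le (hA : ∀ i j, A i j ≠ ⊤) {l : ℝ} (hl : mpRho A ≤ l) :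
    ∃ C : ℝ, ∀ k : ℕ, mpNorm (mpPow A k) ≤ ((k * l + C : ℝ) : EReal) := by
  obtain ⟨M, hlM, hM⟩ := exists_real_upper_bound hA l
  refine ⟨n * (M - l), fun k => iSup₂_le fun i j => ?_⟩
  induction k using Nat.strong_induction_on with
  | _ k ih =>
    rcases lt_or_ge k n with hk | hk
    · refine (mpPow_le_mul hM k i j).trans (EReal.coe_le_coe_iff.mpr ?_)
      have : (k : ℝ) ≤ n := by exact_mod_cast hk.le
      nlinarith
    · obtain ⟨m, r, hm, hmn, rfl, c, hc⟩ := exists_mpPow_le_cycle A k hk i j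
      refine hc.trans ((add_le_add (mpPow_diag_le_of_mpRho_le hl hm hmn c)
        (ih r (by omega))).trans ?_)
      rw [← EReal.coe_add, EReal.coe_le_coe_iff]
      push_cast
      linarith

theorem mul_le_mpPow_mul_diag {m : ℕ} {c : ℝ} {i : Fin n} (h : (c : EReal) ≤ mpPow A m i i)
    (q : ℕ) : ((q * c : ℝ) : EReal) ≤ mpPow A (m * q) i i := by
  induction q with
  | zero => simp [mpPow, mpId]
  | succ q ih =>
    refine le_trans ?_ ((add_le_add ih h).trans (mpPow_add_mpPow_le A (m * q) m i i i))
    rw [← EReal.coe_add, EReal.coe_le_coe_iff]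
    push_cast
    linarith

theorem le_mpNorm_mpPow_of_lt_mpRho (hA : ∀ i j, A i j ≠ ⊤) {l : ℝ} (hl : (l : EReal) < mpRho A) :
    ∃ C : ℝ, ∀ k : ℕ, ((k * l - C : ℝ) : EReal) ≤ mpNorm (mpPow A k) := by
  obtain ⟨m, hm⟩ := lt_iSup_iff.mp hl
  rw [coe_lt_edivNat_iff (by simp)] at hm
  obtain ⟨i, hi⟩ := lt_iSup_iff.mp hm
  set d : ℕ := m + 1
  obtain ⟨M, hlM, hM⟩ := exists_real_upper_bound hA l
  refine ⟨d * (M - l), fun k => ?_⟩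
  obtain ⟨r, hr, hrd⟩ : ∃ r, d * (k / d + 1) = k + r ∧ r ≤ d := by
    refine ⟨d - k % d, ?_, Nat.sub_le _ _⟩
    have h1 := Nat.div_add_mod k d
    have h2 := Nat.mod_lt k (show 0 < d by omega)
    rw [mul_add, mul_one]
    omega
  have h1 := (mul_le_mpPow_mul_diag hi.le (k / d + 1)).trans
    ((mpPow_le_mpNorm _ i i).trans (hr ▸ mpNorm_mpPow_add_le hM k r))
  have h2 := EReal.sub_le_of_le_add h1
  refine le_trans ?_ h2
  rw [← EReal.coe_sub, EReal.coe_le_coe_iff]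
  have hr' : (d : ℝ) * ((k / d + 1 : ℕ) : ℝ) = k + r := by exact_mod_cast hr
  have hrd' : (r : ℝ) ≤ d := by exact_mod_cast hrd
  have : ((k / d + 1 : ℕ) : ℝ) * (d * l) = (k + r) * l := by rw [← hr']; ring
  rw [this]
  nlinarith

end

theorem eventually_const_lt_mul {e : ℝ} (he : 0 < e) (C : ℝ) :
    ∀ᶠ k : ℕ in atTop, 0 < k ∧ C < k * e :=
  (eventually_gt_atTop 0).and
    ((tendsto_natCast_atTop_atTop.atTop_mul_const he).eventually_gt_atTop C)

/-- For every `n×n` matrix `A` over `ℝ ∪ {-∞}`, the sequence `‖A^k‖ / k` converges to the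
max-plus spectral radius `ρ(A)` (with the convention `x / k = -∞` when `x = -∞`). -/
theorem norm_pow_div_tendsto_spectralRadius (n : ℕ) (A : Fin n → Fin n → EReal)
    (hA : ∀ i j, A i j ≠ ⊤) :
    Tendsto (fun k : ℕ => edivNat (mpNorm (mpPow A k)) k) atTop (nhds (mpRho A)) := by
  refine tendsto_order.mpr ⟨fun a ha => ?_, fun a ha => ?_⟩
  · obtain ⟨l, hal, hl⟩ := EReal.lt_iff_exists_real_btwn.mp ha
    obtain ⟨l', hll', hl'⟩ := EReal.lt_iff_exists_real_btwn.mp hl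
    obtain ⟨C, hC⟩ := le_mpNorm_mpPow_of_lt_mpRho hA hl'
    filter_upwards [eventually_const_lt_mul
      (sub_pos.mpr (EReal.coe_lt_coe_iff.mp hll')) C] with k hk
    refine hal.trans ((coe_lt_edivNat_iff hk.1 l).mpr (lt_of_lt_of_le ?_ (hC k)))
    rw [EReal.coe_lt_coe_iff]
    linarith [hk.2]
  · obtain ⟨l, hl, hla⟩ := EReal.lt_iff_exists_real_btwn.mp ha
    obtain ⟨l', hll', hl'⟩ := EReal.lt_iff_exists_real_btwn.mp hla
    obtain ⟨C, hC⟩ := mpNorm_mpPow_le_of_mpRho_le hA hl.le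
    filter_upwards [eventually_const_lt_mul
      (sub_pos.mpr (EReal.coe_lt_coe_iff.mp hll')) C] with k hk
    refine lt_of_le_of_lt ((edivNat_le_coe_iff hk.1 l').mpr ((hC k).trans ?_)) hl'
    rw [EReal.coe_le_coe_iff]
    linarith [hk.2]
end
end

section
/- For every n×n matrix A with all entries in ℝ (i.e., no entry equals -∞), the sequence tr(A^k)/k converges as k → ∞ to the spectral radius ρ(A), where A^k is the k-th max-plus power; that is, lim_{k→∞} tr(A^k)/k = ρ(A). -/
open MeasureTheory ProbabilityTheory Filter
open scoped Classical

noncomputable section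

/-- The weight of the first `k` steps of the walk `p`. -/
def walkWeight {n : ℕ} (A : Fin n → Fin n → ℝ) (p : ℕ → Fin n) (k : ℕ) : ℝ :=
  ∑ t ∈ Finset.range k, A (p t) (p (t + 1))

theorem mpPow_le_iff {n : ℕ} (A : Fin n → Fin n → ℝ) (k : ℕ) (i j : Fin n) (x : EReal) :
    mpPow (fun i j => ((A i j : ℝ) : EReal)) k i j ≤ x ↔
      ∀ p : ℕ → Fin n, p 0 = i → p k = j → (walkWeight A p k : EReal) ≤ x := by
  induction k generalizing j x with
  | zero =>
    by_cases hij : i = j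
    · subst hij
      simp only [mpPow, mpId, walkWeight, if_true, Finset.range_zero, Finset.sum_empty,
        EReal.coe_zero]
      exact ⟨fun h _ _ _ => h, fun h => h (fun _ => i) rfl rfl⟩
    · simp only [mpPow, mpId, hij, if_false, bot_le, true_iff]
      intro p h0 h1
      exact absurd (h0.symm.trans h1) hij
  | succ k ih =>
    have key : ∀ s, (mpPow (fun i j => ((A i j : ℝ) : EReal)) k i s + (A s j : EReal) ≤ x ↔
        mpPow (fun i j => ((A i j : ℝ) : EReal)) k i s ≤ x - (A s j : EReal)) := fun s =>
      (EReal.le_sub_iff_add_le (Or.inl (EReal.coe_ne_bot _)) (Or.inl (EReal.coe_ne_top _))).symm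
    have key' : ∀ (y : ℝ) s, ((y : EReal) ≤ x - (A s j : EReal) ↔
        ((y + A s j : ℝ) : EReal) ≤ x) := fun y s => by
      rw [EReal.le_sub_iff_add_le (Or.inl (EReal.coe_ne_bot _)) (Or.inl (EReal.coe_ne_top _)),
        EReal.coe_add]
    simp only [mpPow, mpMul, iSup_le_iff, key, ih, key']
    constructor
    · intro h p h0 h1
      have := h (p k) p h0 rfl
      rwa [← h1, walkWeight, ← Finset.sum_range_succ] at this
    · intro h s p h0 h1
      have hlt : ∀ t ≤ k, Function.update p (k + 1) j t = p t := fun t ht =>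
        Function.update_of_ne (by omega) _ _
      have := h (Function.update p (k + 1) j) (by rw [hlt 0 (by omega), h0])
        (Function.update_self _ _ _)
      rw [walkWeight, Finset.sum_range_succ, Function.update_self, hlt k le_rfl, h1] at this
      convert this using 3
      refine Finset.sum_congr rfl fun t ht => ?_
      have := Finset.mem_range.mp ht
      rw [hlt t (by omega), hlt (t + 1) (by omega)]

theorem mpTr_mpPow_le_iff {n : ℕ} (A : Fin n → Fin n → ℝ) (k : ℕ) (x : EReal) :
    mpTr (mpPow (fun i j => ((A i j : ℝ) : EReal)) k) ≤ x ↔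
      ∀ p : ℕ → Fin n, p 0 = p k → (walkWeight A p k : EReal) ≤ x := by
  simp only [mpTr, iSup_le_iff, mpPow_le_iff]
  exact ⟨fun h p hp => h (p k) p hp rfl, fun h i p h0 h1 => h p (h0.trans h1.symm)⟩

theorem walkWeight_add {n : ℕ} (A : Fin n → Fin n → ℝ) (p : ℕ → Fin n) (a b : ℕ) :
    walkWeight A p (a + b) = walkWeight A p a + walkWeight A (fun t => p (a + t)) b :=
  Finset.sum_range_add _ _ _

/-- A mean-weight bound on closed walks of length at most `n` holds for all closed walks:
longer ones split at a repeated vertex into two shorter closed walks. -/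
theorem walkWeight_le_of_closed {n : ℕ} {A : Fin n → Fin n → ℝ} {r : ℝ}
    (h : ∀ k, 1 ≤ k → k ≤ n → ∀ p : ℕ → Fin n, p 0 = p k → walkWeight A p k ≤ k * r)
    (k : ℕ) (p : ℕ → Fin n) (hp : p 0 = p k) : walkWeight A p k ≤ k * r := by
  induction k using Nat.strong_induction_on generalizing p with
  | _ k ih =>
  rcases Nat.eq_zero_or_pos k with rfl | hk
  · simp [walkWeight]
  rcases le_or_gt k n with hkn | hkn
  · exact h k hk hkn p hp
  obtain ⟨a, b, hab, hbk, hpab⟩ : ∃ a b, a < b ∧ b < k ∧ p a = p b := by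
    obtain ⟨x, y, hxy, heq⟩ := Fintype.exists_ne_map_eq_of_card_lt (fun t : Fin k => p t)
      (by simpa using hkn)
    rcases lt_or_gt_of_ne hxy with hlt | hlt
    · exact ⟨x, y, hlt, y.2, heq⟩
    · exact ⟨y, x, hlt, x.2, heq.symm⟩
  obtain ⟨d, rfl⟩ := Nat.exists_eq_add_of_le hab.le
  obtain ⟨e, rfl⟩ := Nat.exists_eq_add_of_le hbk.le
  set q : ℕ → Fin n := fun t => if t ≤ a then p t else p (t + d) with hq
  have hqa : ∀ t ≤ a, q t = p t := fun t ht => if_pos ht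
  have hqe : ∀ t, q (a + t) = p (a + d + t) := fun t => by
    rcases Nat.eq_zero_or_pos t with rfl | ht
    · exact (hqa a le_rfl).trans hpab
    · exact (if_neg (by omega)).trans (by congr 1; omega)
  have inner := ih d (by omega) (fun t => p (a + t)) hpab
  have outer := ih (a + e) (by omega) q (by rw [hqa 0 (by omega), hqe, hp])
  have hwa : walkWeight A q a = walkWeight A p a :=
    Finset.sum_congr rfl fun t ht => by
      have := Finset.mem_range.mp ht
      rw [hqa t (by omega), hqa (t + 1) (by omega)]
  rw [walkWeight_add, hwa, funext hqe] at outer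
  rw [walkWeight_add, walkWeight_add]
  push_cast at outer ⊢
  linarith

theorem mpPow_add_le {n : ℕ} (A : Fin n → Fin n → EReal) (k l : ℕ) (i s j : Fin n) :
    mpPow A k i s + mpPow A l s j ≤ mpPow A (k + l) i j := by
  induction l generalizing j with
  | zero =>
    by_cases h : s = j
    · subst h
      simp [mpPow, mpId]
    · simp [mpPow, mpId, h]
  | succ l ih =>
    have : Nonempty (Fin n) := ⟨i⟩
    obtain ⟨u, hu⟩ := exists_eq_ciSup_of_finite (f := fun u => mpPow A l s u + A u j)
    calc mpPow A k i s + mpPow A (l + 1) s j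
        = mpPow A k i s + mpPow A l s u + A u j := by
          rw [add_assoc]; exact congrArg _ hu.symm
      _ ≤ mpPow A (k + l) i u + A u j := by gcongr; exact ih u
      _ ≤ mpPow A (k + (l + 1)) i j :=
          le_iSup (fun u => mpPow A (k + l) i u + A u j) u

theorem mul_le_mpPow_mul {n : ℕ} {A : Fin n → Fin n → EReal} {m : ℕ} {i : Fin n} {y : ℝ}
    (h : (y : EReal) ≤ mpPow A m i i) (q : ℕ) :
    ((q * y : ℝ) : EReal) ≤ mpPow A (m * q) i i := by
  induction q with
  | zero => simp [mpPow, mpId]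
  | succ q ih =>
    calc (((q + 1 : ℕ) * y : ℝ) : EReal) = ((q * y : ℝ) : EReal) + y := by
          rw [← EReal.coe_add, Nat.cast_succ, add_one_mul]
      _ ≤ mpPow A (m * q) i i + mpPow A m i i := add_le_add ih h
      _ ≤ mpPow A (m * (q + 1)) i i := mpPow_add_le A _ _ _ _ _

theorem edivNat_mono {x y : EReal} (h : x ≤ y) (k : ℕ) : edivNat x k ≤ edivNat y k :=
  mul_le_mul_of_nonneg_right h (by exact_mod_cast inv_nonneg.mpr (Nat.cast_nonneg k))

theorem edivNat_coe (x : ℝ) (k : ℕ) : edivNat (x : EReal) k = ((x / k : ℝ) : EReal) := by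
  rw [edivNat, ← EReal.coe_mul, div_eq_mul_inv]

theorem walkWeight_const {n : ℕ} (A : Fin n → Fin n → ℝ) (i : Fin n) (k : ℕ) :
    walkWeight A (fun _ => i) k = k * A i i := by
  simp [walkWeight]

theorem coe_le_mpPow_self {n : ℕ} (A : Fin n → Fin n → ℝ) (i : Fin n) (k : ℕ) :
    ((k * A i i : ℝ) : EReal) ≤ mpPow (fun i j => ((A i j : ℝ) : EReal)) k i i := by
  rw [← walkWeight_const]
  exact (mpPow_le_iff A k i i _).mp le_rfl _ rfl rfl

theorem exists_mpPow_self_eq_coe {n : ℕ} (A : Fin n → Fin n → ℝ) (i : Fin n) (k : ℕ) :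
    ∃ y : ℝ, mpPow (fun i j => ((A i j : ℝ) : EReal)) k i i = y := by
  obtain ⟨M, hM⟩ := (Set.finite_range fun x : Fin n × Fin n => A x.1 x.2).bddAbove
  have hle : mpPow (fun i j => ((A i j : ℝ) : EReal)) k i i ≤ ((k * M : ℝ) : EReal) := by
    rw [mpPow_le_iff]
    intro p _ _
    refine EReal.coe_le_coe_iff.mpr ((Finset.sum_le_card_nsmul _ _ M fun t _ =>
      hM ⟨(p t, p (t + 1)), rfl⟩).trans (by simp))
  refine ⟨_, (EReal.coe_toReal (ne_top_of_le_ne_top (EReal.coe_ne_top _) hle)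
    (ne_bot_of_le_ne_bot (EReal.coe_ne_bot _) (coe_le_mpPow_self A i k))).symm⟩

theorem exists_mpRho_eq {n : ℕ} [NeZero n] (A : Fin n → Fin n → ℝ) :
    ∃ (m : ℕ) (i : Fin n) (r : ℝ), 1 ≤ m ∧
      mpRho (fun i j => ((A i j : ℝ) : EReal)) = r ∧
      mpPow (fun i j => ((A i j : ℝ) : EReal)) m i i = ((m * r : ℝ) : EReal) := by
  obtain ⟨m, hm⟩ := exists_eq_ciSup_of_finite (f := fun m : Fin n =>
    edivNat (mpTr (mpPow (fun i j => ((A i j : ℝ) : EReal)) ((m : ℕ) + 1))) ((m : ℕ) + 1))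
  obtain ⟨i, hi⟩ := exists_eq_ciSup_of_finite (f := fun i : Fin n =>
    mpPow (fun i j => ((A i j : ℝ) : EReal)) ((m : ℕ) + 1) i i)
  obtain ⟨y, hy⟩ := exists_mpPow_self_eq_coe A i (m + 1)
  refine ⟨m + 1, i, y / (m + 1 : ℕ), by omega, ?_, ?_⟩
  · rw [mpRho, ← hm, mpTr, ← hi, hy, edivNat_coe]
  · rw [hy, mul_div_cancel₀ _ (by positivity)]

theorem mpTr_mpPow_le {n : ℕ} {A : Fin n → Fin n → ℝ} {r : ℝ}
    (hr : mpRho (fun i j => ((A i j : ℝ) : EReal)) ≤ r) (k : ℕ) :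
    mpTr (mpPow (fun i j => ((A i j : ℝ) : EReal)) k) ≤ ((k * r : ℝ) : EReal) := by
  rw [mpTr_mpPow_le_iff]
  intro p hp
  refine EReal.coe_le_coe_iff.mpr (walkWeight_le_of_closed (fun m hm hmn p hp => ?_) k p hp)
  have hmr := iSup_le_iff.mp hr ⟨m - 1, by omega⟩
  simp only [Nat.sub_add_cancel hm] at hmr
  have := (edivNat_mono ((mpTr_mpPow_le_iff A m _).mp le_rfl p hp) m).trans hmr
  rw [edivNat_coe, EReal.coe_le_coe_iff, div_le_iff₀ (by exact_mod_cast hm)] at this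
  linarith

theorem exists_le_mpTr_mpPow {n : ℕ} {A : Fin n → Fin n → ℝ} {m : ℕ} {i : Fin n} {r : ℝ}
    (hm : 1 ≤ m)
    (h : mpPow (fun i j => ((A i j : ℝ) : EReal)) m i i = ((m * r : ℝ) : EReal)) :
    ∃ C : ℝ, ∀ k : ℕ,
      ((k * r - C : ℝ) : EReal) ≤ mpTr (mpPow (fun i j => ((A i j : ℝ) : EReal)) k) := by
  refine ⟨m * |A i i - r|, fun k => ?_⟩
  have hsplit : m * (k / m) + k % m = k := Nat.div_add_mod k m
  have hmod : ((k % m : ℕ) : ℝ) ≤ m := by exact_mod_cast (Nat.mod_lt k hm).le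
  have hreal : (k * r - m * |A i i - r| : ℝ) ≤
      (k / m : ℕ) * (m * r) + (k % m : ℕ) * A i i := by
    have hk : (k : ℝ) = m * (k / m : ℕ) + (k % m : ℕ) := by exact_mod_cast hsplit.symm
    have h1 := mul_le_mul_of_nonneg_right hmod (abs_nonneg (A i i - r))
    have h2 := mul_le_mul_of_nonneg_left (neg_abs_le (A i i - r))
      (Nat.cast_nonneg (α := ℝ) (k % m))
    rw [hk]
    linarith
  calc ((k * r - m * |A i i - r| : ℝ) : EReal)
      ≤ (((k / m : ℕ) * (m * r) : ℝ) : EReal) + (((k % m : ℕ) * A i i : ℝ) : EReal) := by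
        rw [← EReal.coe_add]; exact EReal.coe_le_coe_iff.mpr hreal
    _ ≤ mpPow _ (m * (k / m)) i i + mpPow _ (k % m) i i :=
        add_le_add (mul_le_mpPow_mul h.ge _) (coe_le_mpPow_self A i _)
    _ ≤ mpPow _ (m * (k / m) + k % m) i i := mpPow_add_le _ _ _ _ _ _
    _ = mpPow (fun i j => ((A i j : ℝ) : EReal)) k i i := by rw [hsplit]
    _ ≤ mpTr (mpPow (fun i j => ((A i j : ℝ) : EReal)) k) :=
        le_iSup (fun i => mpPow (fun i j => ((A i j : ℝ) : EReal)) k i i) i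

/-- For every `n×n` matrix `A` with all entries real (no `-∞` entry), the sequence
`tr(A^k) / k` of max-plus traces of max-plus powers converges to the max-plus spectral
radius `ρ(A)`. -/
theorem trace_pow_div_tendsto_spectralRadius (n : ℕ) (A : Fin n → Fin n → ℝ) :
    Tendsto
      (fun k : ℕ => edivNat (mpTr (mpPow (fun i j => ((A i j : ℝ) : EReal)) k)) k)
      atTop (nhds (mpRho (fun i j => ((A i j : ℝ) : EReal)))) := by
  rcases Nat.eq_zero_or_pos n with rfl | hn
  · refine tendsto_const_nhds.congr' ?_
    filter_upwards [eventually_gt_atTop 0] with k hk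
    rw [mpRho, mpTr, iSup_of_empty, iSup_of_empty, edivNat,
      EReal.bot_mul_coe_of_pos (by positivity)]
  have : NeZero n := ⟨hn.ne'⟩
  obtain ⟨m, i, r, hm, hr, hmr⟩ := exists_mpRho_eq A
  obtain ⟨C, hC⟩ := exists_le_mpTr_mpPow hm hmr
  rw [hr]
  have hlim : Tendsto (fun k : ℕ => ((r - C / k : ℝ) : EReal)) atTop (nhds r) := by
    refine (continuous_coe_real_ereal.tendsto r).comp ?_
    simpa using tendsto_const_nhds.sub (tendsto_const_div_atTop_nhds_zero_nat C)
  refine tendsto_of_tendsto_of_tendsto_of_le_of_le' hlim tendsto_const_nhds ?_ ?_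
  · filter_upwards [eventually_gt_atTop 0] with k hk
    have := edivNat_mono (hC k) k
    rwa [edivNat_coe, sub_div, mul_div_cancel_left₀ _ (by positivity)] at this
  · filter_upwards [eventually_gt_atTop 0] with k hk
    have := edivNat_mono (mpTr_mpPow_le hr.le k) k
    rwa [edivNat_coe, mul_div_cancel_left₀ _ (by positivity)] at this
end
end

section
/- For every n×n matrix A with entries in ℝ ∪ {-∞} and every integer k ≥ 1, the inequality ‖A^k‖ ≥ k·ρ(A) holds in ℝ ∪ {-∞}, where A^k denotes the k-th max-plus power of A (with the convention k·(-∞) = -∞). -/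
open MeasureTheory ProbabilityTheory Filter
open scoped Classical

noncomputable section

theorem add_le_mpMul {m n l : ℕ} (A : Fin m → Fin n → EReal) (B : Fin n → Fin l → EReal)
    (i : Fin m) (s : Fin n) (j : Fin l) : A i s + B s j ≤ mpMul A B i j :=
  le_iSup (fun s => A i s + B s j) s

theorem mpMul_le_iff {m n l : ℕ} {A : Fin m → Fin n → EReal} {B : Fin n → Fin l → EReal}
    {i : Fin m} {j : Fin l} {c : EReal} : mpMul A B i j ≤ c ↔ ∀ s, A i s + B s j ≤ c :=
  iSup_le_iff

/-- An entry of a max-plus product is attained as soon as the inner index set is nonempty. -/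
theorem exists_mpMul_eq {m n l : ℕ} [Nonempty (Fin n)] (A : Fin m → Fin n → EReal)
    (B : Fin n → Fin l → EReal) (i : Fin m) (j : Fin l) :
    ∃ s, A i s + B s j = mpMul A B i j :=
  exists_eq_ciSup_of_finite

theorem mpMul_assoc {n : ℕ} (A B C : Fin n → Fin n → EReal) :
    mpMul (mpMul A B) C = mpMul A (mpMul B C) := by
  funext i j
  have : Nonempty (Fin n) := ⟨i⟩
  refine le_antisymm (mpMul_le_iff.2 fun s => ?_) (mpMul_le_iff.2 fun s => ?_)
  · obtain ⟨r, hr⟩ := exists_mpMul_eq A B i s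
    rw [← hr, add_assoc]
    exact (add_le_add_right (add_le_mpMul B C r s j) _).trans (add_le_mpMul A _ i r j)
  · obtain ⟨r, hr⟩ := exists_mpMul_eq B C s j
    rw [← hr, ← add_assoc]
    exact (add_le_add_left (add_le_mpMul A B i s r) _).trans (add_le_mpMul _ C i r j)

theorem mpMul_mpId {m n : ℕ} (A : Fin m → Fin n → EReal) : mpMul A mpId = A := by
  funext i j
  refine le_antisymm (mpMul_le_iff.2 fun s => ?_) ?_
  · by_cases h : s = j <;> simp [mpId, h]
  · simpa [mpId] using add_le_mpMul A mpId i j j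

theorem mpPow_add {n : ℕ} (A : Fin n → Fin n → EReal) (a b : ℕ) :
    mpPow A (a + b) = mpMul (mpPow A a) (mpPow A b) := by
  induction b with
  | zero => exact (mpMul_mpId _).symm
  | succ b ih =>
    change mpMul (mpPow A (a + b)) A = mpMul _ (mpMul (mpPow A b) A)
    rw [ih, mpMul_assoc]

theorem le_mpNorm {m n : ℕ} (A : Fin m → Fin n → EReal) (i : Fin m) (j : Fin n) :
    A i j ≤ mpNorm A :=
  le_iSup₂ (f := fun i j => A i j) i j

theorem nsmul_mpPow_diag_le {n : ℕ} (A : Fin n → Fin n → EReal) (p k : ℕ) (i : Fin n) :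
    k • mpPow A p i i ≤ mpPow A (p * k) i i := by
  induction k with
  | zero => simp [mpPow, mpId]
  | succ k ih =>
    rw [succ_nsmul, Nat.mul_succ, mpPow_add]
    exact (add_le_add_left ih _).trans (add_le_mpMul _ _ i i i)

theorem mpPow_mul_le_nsmul_mpNorm {n : ℕ} (A : Fin n → Fin n → EReal) (k p : ℕ) (i j : Fin n) :
    mpPow A (k * p) i j ≤ p • mpNorm (mpPow A k) := by
  induction p generalizing i j with
  | zero => by_cases h : i = j <;> simp [mpPow, mpId, h]
  | succ p ih =>
    rw [succ_nsmul, Nat.mul_succ, mpPow_add]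
    exact mpMul_le_iff.2 fun s => add_le_add (ih i s) (le_mpNorm _ s j)

theorem edivNat_eq_div (x : EReal) (k : ℕ) : edivNat x k = x / (k : EReal) := by
  rw [edivNat, EReal.coe_inv, EReal.coe_natCast, div_eq_mul_inv]

/-- For every `n×n` matrix `A` over `ℝ ∪ {-∞}` and every `k ≥ 1`, one has
`‖A^k‖ ≥ k · ρ(A)` in `ℝ ∪ {-∞}` (with the convention `k · (-∞) = -∞`). -/
theorem norm_pow_ge_spectralRadius (n : ℕ) (A : Fin n → Fin n → EReal)
    (hA : ∀ i j, A i j ≠ ⊤) (k : ℕ) (hk : 1 ≤ k) :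
    (k : EReal) * mpRho A ≤ mpNorm (mpPow A k) := by
  have natCast_pos {q : ℕ} (hq : 0 < q) : (0 : EReal) < q := by exact_mod_cast hq
  rw [mul_comm, ← EReal.le_div_iff_mul_le (natCast_pos hk) (EReal.natCast_ne_top k)]
  refine iSup_le fun m => ?_
  have hp : 0 < (m : ℕ) + 1 := Nat.succ_pos m
  generalize (m : ℕ) + 1 = p at hp ⊢
  rw [edivNat_eq_div, EReal.div_le_iff_le_mul (natCast_pos hp)
    (EReal.natCast_ne_top p)]
  refine iSup_le fun i => ?_
  rw [EReal.mul_div, EReal.le_div_iff_mul_le (natCast_pos hk) (EReal.natCast_ne_top k),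
    mul_comm, ← EReal.nsmul_eq_mul, ← EReal.nsmul_eq_mul]
  calc k • mpPow A p i i ≤ mpPow A (p * k) i i := nsmul_mpPow_diag_le A p k i
    _ = mpPow A (k * p) i i := by rw [mul_comm]
    _ ≤ p • mpNorm (mpPow A k) := mpPow_mul_le_nsmul_mpNorm A k p i i
end
end

section
/- Let n ≥ 1, let τ₁, …, τ_n ∈ ℝ, and over the max-plus semiring define T = diag(τ₁, …, τ_n) (the n×n matrix with (i,i) entry τ_i and all other entries -∞), G the n×n matrix with (i, i+1) entry 0 for i = 1, …, n-1 and all other entries -∞, and I the max-plus identity matrix. Then the matrix (I ⊕ T ⊗ Gᵀ)^{n-1} ⊗ T, where ⊕ is entrywise maximum, powers are max-plus powers, and ⊗ is the max-plus product, has (i,j) entry equal to τ_j + τ_{j+1} + ⋯ + τ_i when j ≤ i, and equal to -∞ when j > i. -/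
open MeasureTheory ProbabilityTheory Filter
open scoped Classical

noncomputable section

/-- The entries of the `k`-th max-plus power of `I ⊕ T ⊗ Gᵀ`. -/
def tandemPower {n : ℕ} (τ : Fin n → ℝ) (k : ℕ) : Fin n → Fin n → EReal := fun i j =>
  if j ≤ i ∧ (i : ℕ) ≤ j + k then ((∑ s ∈ Finset.Ioc j i, τ s : ℝ) : EReal) else ⊥

theorem sum_Ioc_add_left {n : ℕ} (τ : Fin n → ℝ) {i j : Fin n} (h : j ≤ i) :
    ∑ s ∈ Finset.Ioc j i, τ s + τ j = ∑ s ∈ Finset.Icc j i, τ s := by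
  rw [← Finset.Ioc_insert_left h, Finset.sum_insert (by simp), add_comm]

theorem Ioc_eq_Icc_of_val_succ {n : ℕ} {i j s : Fin n} (h : (j : ℕ) + 1 = s) :
    Finset.Ioc j i = Finset.Icc s i := by
  ext x
  simp only [Finset.mem_Ioc, Finset.mem_Icc, Fin.lt_def, Fin.le_def]
  omega

/-- Right multiplication by a diagonal matrix adds the diagonal entry to each column. -/
theorem mpMul_diag {m n : ℕ} (A : Fin m → Fin n → EReal) {T : Fin n → Fin n → EReal}
    {d : Fin n → EReal} (hT : ∀ i j, T i j = if i = j then d i else ⊥) (i : Fin m) (j : Fin n) :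
    mpMul A T i j = A i j + d j := by
  refine le_antisymm (iSup_le fun s => ?_) (le_iSup_of_le j (by simp [hT]))
  rw [hT]
  split_ifs with h
  · rw [h]
  · simp

/-- Left multiplication by a diagonal matrix adds the diagonal entry to each row. -/
theorem diag_mpMul {m n : ℕ} (A : Fin m → Fin n → EReal) {T : Fin m → Fin m → EReal}
    {d : Fin m → EReal} (hT : ∀ i j, T i j = if i = j then d i else ⊥) (i : Fin m) (j : Fin n) :
    mpMul T A i j = d i + A i j := by
  refine le_antisymm (iSup_le fun s => ?_) (le_iSup_of_le i (by simp [hT]))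
  rw [hT]
  split_ifs with h
  · rw [h]
  · simp

theorem tandemPower_zero {n : ℕ} (τ : Fin n → ℝ) : tandemPower τ 0 = mpId := by
  funext i j
  by_cases h : i = j
  · simp [tandemPower, mpId, h]
  · have : ¬ (j ≤ i ∧ (i : ℕ) ≤ j + 0) := by
      simp only [Fin.le_def]
      omega
    rw [tandemPower, if_neg this, mpId, if_neg h]

theorem tandemPower_succ {n : ℕ} (τ : Fin n → ℝ) {M : Fin n → Fin n → EReal}
    (hM : ∀ i j, M i j =
      if i = j then 0 else if (j : ℕ) + 1 = i then ((τ i : ℝ) : EReal) else ⊥) (k : ℕ) :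
    mpMul (tandemPower τ k) M = tandemPower τ (k + 1) := by
  have step : ∀ {i j s : Fin n}, (j : ℕ) + 1 = s → s ≤ i →
      ((∑ t ∈ Finset.Ioc s i, τ t : ℝ) : EReal) + ((τ s : ℝ) : EReal) =
        ((∑ t ∈ Finset.Ioc j i, τ t : ℝ) : EReal) := by
    intro i j s hs hi
    rw [← EReal.coe_add, sum_Ioc_add_left τ hi, Ioc_eq_Icc_of_val_succ hs]
  funext i j
  apply le_antisymm
  · refine iSup_le fun s => ?_
    rw [hM]
    split_ifs with h₁ h₂
    · subst h₁
      rw [add_zero, tandemPower]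
      split_ifs with h
      · rw [tandemPower, if_pos ⟨h.1, by omega⟩]
      · exact bot_le
    · rw [tandemPower]
      split_ifs with h
      · have hj : j ≤ i := by
          have := h.1
          simp only [Fin.le_def] at this ⊢
          omega
        rw [step h₂ h.1, tandemPower, if_pos ⟨hj, by omega⟩]
      · simp
    · simp
  · rw [tandemPower]
    split_ifs with h
    · by_cases hk : (i : ℕ) ≤ j + k
      · refine le_iSup_of_le j ?_
        rw [hM, if_pos rfl, add_zero, tandemPower, if_pos ⟨h.1, hk⟩]
      · obtain ⟨s, hs⟩ : ∃ s : Fin n, (j : ℕ) + 1 = s := ⟨⟨j + 1, by omega⟩, rfl⟩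
        have hsi : s ≤ i := by
          simp only [Fin.le_def]
          omega
        refine le_iSup_of_le s ?_
        rw [hM, if_neg (by omega), if_pos hs, tandemPower, if_pos ⟨hsi, by omega⟩, step hs hsi]
    · exact bot_le

theorem mpPow_eq_tandemPower {n : ℕ} (τ : Fin n → ℝ) {M : Fin n → Fin n → EReal}
    (hM : ∀ i j, M i j =
      if i = j then 0 else if (j : ℕ) + 1 = i then ((τ i : ℝ) : EReal) else ⊥) (k : ℕ) :
    mpPow M k = tandemPower τ k := by
  induction k with
  | zero => rw [tandemPower_zero, mpPow]
  | succ k ih => rw [mpPow, ih, tandemPower_succ τ hM]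

/-- The state transition matrix `(I ⊕ T ⊗ Gᵀ)^{n-1} ⊗ T` of an open tandem queueing
network of `n` nodes with infinite buffers, where `T = diag(τ₁, …, τ_n)` and `G` has
entries `G_{i,i+1} = 0` and `-∞` elsewhere, has `(i,j)` entry `τ_j + τ_{j+1} + ⋯ + τ_i`
when `j ≤ i` and `-∞` when `j > i`. -/
theorem tandem_state_transition_matrix (n : ℕ) (hn : 1 ≤ n) (τ : Fin n → ℝ)
    (T G : Fin n → Fin n → EReal)
    (hT : ∀ i j, T i j = if i = j then ((τ i : ℝ) : EReal) else ⊥)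
    (hG : ∀ i j, G i j = if (i : ℕ) + 1 = (j : ℕ) then (0 : EReal) else ⊥) :
    (∀ i j : Fin n, j ≤ i →
        mpMul (mpPow (mpAdd mpId (mpMul T (fun i j => G j i))) (n - 1)) T i j =
          ((∑ s ∈ Finset.Icc j i, τ s : ℝ) : EReal)) ∧
    (∀ i j : Fin n, i < j →
        mpMul (mpPow (mpAdd mpId (mpMul T (fun i j => G j i))) (n - 1)) T i j = ⊥) := by
  have hM : ∀ i j, mpAdd mpId (mpMul T (fun i j => G j i)) i j =
      if i = j then 0 else if (j : ℕ) + 1 = i then ((τ i : ℝ) : EReal) else ⊥ := by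
    intro i j
    rw [mpAdd, diag_mpMul _ hT, hG, mpId]
    by_cases h₁ : i = j
    · simp [h₁]
    · by_cases h₂ : (j : ℕ) + 1 = i <;> simp [h₁, h₂]
  simp only [mpPow_eq_tandemPower τ hM, mpMul_diag _ hT]
  constructor
  · intro i j h
    rw [tandemPower, if_pos ⟨h, by omega⟩, ← EReal.coe_add, sum_Ioc_add_left τ h]
  · intro i j h
    rw [tandemPower, if_neg fun h' => h.not_ge h'.1, EReal.bot_add]
end
end
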